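/- arXiv:1808.03564 — 3 statements merged into one kernel-verified Lean document; each statement's English description precedes it below -/
import Mathlib

section
/- Let (𝒜, ℬ, 𝒞) be a recollement of abelian categories, all with enough projectives and injectives. If there is t such that id_ℬ i(A) ≤ t for every object A of 𝒜, then for every object C of 𝒞 one has id_ℬ r(C) ≤ id_𝒞 C + t + 1; in particular, the functor r : 𝒞 ⥤ ℬ preserves objects of finite injective dimension. -/
/-!
A recollement `(𝒜, ℬ, 𝒞)` of abelian categories consists of functors `i : 𝒜 ⥤ ℬ`,
`e : ℬ ⥤ 𝒞`, `q, p : ℬ ⥤ 𝒜` and `l, r : 𝒞 ⥤ ℬ` such that `(l, e)`, `(e, r)`, `(q, i)`,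
`(i, p)` are adjoint pairs, the functors `i`, `l` and `r` are fully faithful, and the
essential image of `i` equals the kernel of `e`.

STATEMENT: if all three categories have enough projectives and injectives and there is `t`
such that `id_ℬ i(A) ≤ t` for every object `A` of `𝒜`, then for every object `C` of `𝒞` one
has `id_ℬ r(C) ≤ id_𝒞 C + t + 1`; in particular `r : 𝒞 ⥤ ℬ` preserves objects of finite
injective dimension.
-/

open CategoryTheory CategoryTheory.Limits

universe w v₁ v₂ v₃ u₁ u₂ u₃

/-- A recollement `(𝒜, ℬ, 𝒞)` of abelian categories. -/
structure Recollement (A : Type u₁) (B : Type u₂) (C : Type u₃)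
    [Category.{v₁} A] [Category.{v₂} B] [Category.{v₃} C]
    [Abelian A] [Abelian B] [Abelian C] where
  /-- the inclusion functor -/
  i : A ⥤ B
  /-- the quotient functor -/
  e : B ⥤ C
  /-- the left adjoint of `i` -/
  q : B ⥤ A
  /-- the right adjoint of `i` -/
  p : B ⥤ A
  /-- the left adjoint of `e` -/
  l : C ⥤ B
  /-- the right adjoint of `e` -/
  r : C ⥤ B
  /-- `(l, e)` is an adjoint pair -/
  adj_le : l ⊣ e
  /-- `(e, r)` is an adjoint pair -/
  adj_er : e ⊣ r
  /-- `(q, i)` is an adjoint pair -/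
  adj_qi : q ⊣ i
  /-- `(i, p)` is an adjoint pair -/
  adj_ip : i ⊣ p
  i_full : i.Full
  i_faithful : i.Faithful
  l_full : l.Full
  l_faithful : l.Faithful
  r_full : r.Full
  r_faithful : r.Faithful
  /-- the essential image of `i` is the kernel of `e` -/
  essImage_i_eq_ker_e : ∀ X : B, i.essImage X ↔ IsZero (e.obj X)

/-- The projective dimension of an object of an abelian category, as an element of `ℕ∞`:
the least `n` such that `X` admits a projective resolution
`0 → P_n → ⋯ → P_0 → X → 0` (and `⊤` if there is no such `n`). -/
noncomputable def projDim {C : Type u₁} [Category.{v₁} C] [Abelian C] (X : C) : ℕ∞ :=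
  ⨅ (n : ℕ) (_ : ∃ P : CategoryTheory.ProjectiveResolution X,
    ∀ k, n < k → IsZero (P.complex.X k)), (n : ℕ∞)

/-- The injective dimension of an object of an abelian category, as an element of `ℕ∞`:
the least `n` such that `X` admits an injective coresolution
`0 → X → I^0 → ⋯ → I^n → 0` (and `⊤` if there is no such `n`). -/
noncomputable def injDim {C : Type u₁} [Category.{v₁} C] [Abelian C] (X : C) : ℕ∞ :=
  ⨅ (n : ℕ) (_ : ∃ I : CategoryTheory.InjectiveResolution X,
    ∀ k, n < k → IsZero (I.cocomplex.X k)), (n : ℕ∞)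

/-- The finitistic projective dimension of an abelian category: the supremum of the
projective dimensions of the objects having finite projective dimension. -/
noncomputable def catFindim (C : Type u₁) [Category.{v₁} C] [Abelian C] : ℕ∞ :=
  ⨆ (X : C) (_ : projDim X ≠ ⊤), projDim X

/-- An object of an abelian category has finite length if it admits a finite filtration
`⊥ = X_0 < X_1 < ⋯ < X_n = ⊤` by subobjects whose successive quotients are simple
(a finite composition series). -/
def FiniteLengthObj {C : Type u₁} [Category.{v₁} C] [Abelian C] (X : C) : Prop :=
  ∃ (n : ℕ) (f : Fin (n + 1) → Subobject X), f 0 = ⊥ ∧ f (Fin.last n) = ⊤ ∧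
    ∀ j : Fin n, ∃ h : f j.castSucc ≤ f j.succ,
      Simple (cokernel (Subobject.ofLE (f j.castSucc) (f j.succ) h))

/-- An abelian category is a finite length category if every object has a finite
composition series. -/
def FiniteLengthCategory (C : Type u₁) [Category.{v₁} C] [Abelian C] : Prop :=
  ∀ X : C, FiniteLengthObj X

/-- An abelian category has projective covers if every object `X` admits an epimorphism
`f : P → X` with `P` projective whose kernel is superfluous, i.e. contained in the radical
of `P` (the intersection of all maximal subobjects of `P`). -/
def HasProjectiveCovers (C : Type u₁) [Category.{v₁} C] [Abelian C] : Prop :=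
  ∀ X : C, ∃ (P : C) (_ : Projective P) (f : P ⟶ X), Epi f ∧
    ∀ m : Subobject P, IsCoatom m → kernelSubobject f ≤ m


namespace CategoryTheory

variable {D : Type u₁} [Category.{v₁} D] [Abelian D]

namespace InjectiveResolution

/-- A cochain complex `K` of injective objects which is exact in positive degrees, together with
a kernel `f : Z ⟶ K.X 0` of its first differential, is an injective resolution of `Z`. -/
noncomputable def ofExact {Z : D} (K : CochainComplex D ℕ) (hK : ∀ n, Injective (K.X n))
    (f : Z ⟶ K.X 0) (hf₀ : Mono f) (w : f ≫ K.d 0 1 = 0)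
    (hf : (ShortComplex.mk f (K.d 0 1) w).Exact)
    (hsucc : ∀ n, K.ExactAt (n + 1)) : InjectiveResolution Z where
  cocomplex := K
  injective := hK
  ι := (CochainComplex.fromSingle₀Equiv _ _).symm ⟨f, w⟩
  quasiIso := ⟨fun n => by
    cases n
    · rw [CochainComplex.quasiIsoAt₀_iff, ShortComplex.quasiIso_iff_of_zeros]
      · refine (ShortComplex.exact_and_mono_f_iff_of_iso ?_).2 ⟨hf, by dsimp; infer_instance⟩
        exact ShortComplex.isoMk (Iso.refl _) (Iso.refl _) (Iso.refl _)
          (by simp; exact (Category.id_comp f).trans (Category.comp_id f).symm)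
          ((Category.id_comp (K.d 0 1)).trans (Category.comp_id (K.d 0 1)).symm)
      · rfl
      · rfl
      · exact K.shape _ _ (by simp)
    · rw [quasiIsoAt_iff_exactAt]
      · apply hsucc
      · apply CochainComplex.exactAt_succ_single_obj⟩

/-- Splicing a short exact sequence `0 ⟶ X₁ ⟶ X₂ ⟶ X₃ ⟶ 0`, with `X₂` injective, with an
injective resolution `0 ⟶ X₃ ⟶ K⁰ ⟶ K¹ ⟶ ⋯` of `X₃`. -/
noncomputable def splice {S : ShortComplex D} (hS : S.ShortExact) (h₂ : Injective S.X₂)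
    (K : CochainComplex D ℕ) (hK : ∀ n, Injective (K.X n)) (j : S.X₃ ⟶ K.X 0)
    (hj₀ : Mono j) (w : j ≫ K.d 0 1 = 0) (hj : (ShortComplex.mk j (K.d 0 1) w).Exact)
    (hsucc : ∀ n, K.ExactAt (n + 1)) : InjectiveResolution S.X₁ :=
  have w' : (S.g ≫ j) ≫ K.d 0 1 = 0 := by rw [Category.assoc, w, comp_zero]
  have hf : S.f ≫ S.g ≫ j = 0 := by rw [S.zero_assoc, zero_comp]
  ofExact (K.augment (S.g ≫ j) w')
    (fun n ↦ match n with
      | 0 => h₂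
      | n + 1 => hK n)
    S.f hS.mono_f hf
    (by
      let α : S ⟶ ShortComplex.mk S.f (S.g ≫ j) hf := { τ₁ := 𝟙 _, τ₂ := 𝟙 _, τ₃ := j }
      exact (ShortComplex.exact_iff_of_epi_of_isIso_of_mono α).1 hS.exact)
    (fun n ↦ by
      rw [HomologicalComplex.exactAt_iff' _ n (n + 1) (n + 1 + 1) (by simp) (by simp)]
      match n with
      | 0 =>
        let β : ShortComplex.mk (S.g ≫ j) (K.d 0 1) w' ⟶ ShortComplex.mk j (K.d 0 1) w :=
          { τ₁ := S.g, τ₂ := 𝟙 _, τ₃ := 𝟙 _ }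
        have : Epi β.τ₁ := hS.epi_g
        exact (ShortComplex.exact_iff_of_epi_of_isIso_of_mono β).2 hj
      | n + 1 =>
        exact (HomologicalComplex.exactAt_iff' _ n (n + 1) (n + 1 + 1) (by simp) (by simp)).1
          (hsucc n))

end InjectiveResolution

lemma hasInjectiveDimensionLT_iff_exists_injectiveResolution [EnoughInjectives D] (X : D) (n : ℕ) :
    HasInjectiveDimensionLT X (n + 1) ↔
      ∃ I : InjectiveResolution X, ∀ k, n < k → IsZero (I.cocomplex.X k) := by
  refine ⟨fun h ↦ ?_, fun ⟨I, hI⟩ ↦ ?_⟩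
  · induction n generalizing X with
    | zero =>
      have := injective_iff_hasInjectiveDimensionLT_one.2 h
      exact ⟨InjectiveResolution.self X,
        fun k hk ↦ HomologicalComplex.isZero_single_obj_X _ _ _ _ (by lia)⟩
    | succ n hn =>
      let P := Classical.choice (EnoughInjectives.presentation X)
      have hP := P.shortExact_shortComplex
      obtain ⟨J, hJ⟩ := hn _ ((hP.hasInjectiveDimensionLT_X₃_iff n P.injective).2 h)
      refine ⟨InjectiveResolution.splice hP P.injective J.cocomplex J.injective (J.ι.f 0)
        (inferInstanceAs (Mono (J.ι.f 0))) J.ι_f_zero_comp_complex_d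
        (ShortComplex.exact_of_f_is_kernel _ J.isLimitKernelFork) J.cocomplex_exactAt_succ, fun k hk ↦ ?_⟩
      obtain _ | k := k
      · lia
      · exact hJ k (by lia)
  · let := HasExt.standard D
    rw [hasInjectiveDimensionLT_iff]
    intro k hk Y x
    obtain ⟨f, hf, rfl⟩ := I.extMk_surjective x (k + 1) rfl
    obtain rfl : f = 0 := (hI k hk).eq_of_tgt _ _
    exact I.extMk_zero _ _

lemma hasInjectiveDimensionLT_kernel {X Y : D} (f : X ⟶ Y) (n : ℕ) [Injective X]
    (hY : HasInjectiveDimensionLT Y (n + 1)) (hf : HasInjectiveDimensionLT (cokernel f) n) :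
    HasInjectiveDimensionLT (kernel f) (n + 2) := by
  have h₁ : (ShortComplex.mk (Abelian.image.ι f) (cokernel.π f)
      (kernel.condition _)).ShortExact := { exact := ShortComplex.exact_kernel _ }
  have h₂ : (ShortComplex.mk (kernel.ι f) (Abelian.factorThruImage f)
      (by simp [← cancel_mono (Abelian.image.ι f)])).ShortExact :=
    { exact := by
        let α : ShortComplex.mk (kernel.ι f) (Abelian.factorThruImage f)
            (by simp [← cancel_mono (Abelian.image.ι f)]) ⟶
            ShortComplex.mk (kernel.ι f) f (kernel.condition f) :=
          { τ₁ := 𝟙 _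
            τ₂ := 𝟙 _
            τ₃ := Abelian.image.ι f }
        have : Mono α.τ₃ := inferInstanceAs (Mono (Abelian.image.ι f))
        exact (ShortComplex.exact_iff_of_epi_of_isIso_of_mono α).2 (ShortComplex.exact_kernel f) }
  exact h₂.hasInjectiveDimensionLT_X₁ (n + 1) (h₁.hasInjectiveDimensionLT_X₁ n hf hY)
    (hasInjectiveDimensionLT_of_ge X 1 _ (by lia))

end CategoryTheory

lemma injDim_le_iff {D : Type u₁} [Category.{v₁} D] [Abelian D] [EnoughInjectives D] (X : D)
    (n : ℕ) : injDim X ≤ n ↔ HasInjectiveDimensionLE X n := by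
  refine ⟨fun h ↦ ?_, fun h ↦
    iInf₂_le n ((hasInjectiveDimensionLT_iff_exists_injectiveResolution X n).1 h)⟩
  have h' : injDim X < ((n + 1 : ℕ) : ℕ∞) := h.trans_lt (by exact_mod_cast n.lt_succ_self)
  simp only [injDim, iInf_lt_iff] at h'
  obtain ⟨m, hI, hm⟩ := h'
  have := (hasInjectiveDimensionLT_iff_exists_injectiveResolution X m).2 hI
  exact hasInjectiveDimensionLT_of_ge X (m + 1) _ (by exact_mod_cast hm)

namespace Recollement

variable {A : Type u₁} {B : Type u₂} {C : Type u₃}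
  [Category.{v₁} A] [Category.{v₂} B] [Category.{v₃} C]
  [Abelian A] [Abelian B] [Abelian C] (R : Recollement A B C)

lemma injective_r_obj (Y : C) [Injective Y] : Injective (R.r.obj Y) := by
  have := R.adj_le.isRightAdjoint
  exact Injective.injective_of_adjoint R.adj_er Y

lemma isZero_e_obj_cokernel_r_map {X Y : C} (g : X ⟶ Y) [Epi g] :
    IsZero (R.e.obj (cokernel (R.r.map g))) := by
  have := R.adj_er.isLeftAdjoint
  have := R.r_full
  have := R.r_faithful
  have : Epi (R.e.map (R.r.map g)) := by
    have h : R.e.map (R.r.map g) =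
        R.adj_er.counit.app X ≫ g ≫ inv (R.adj_er.counit.app Y) := by
      simp [← R.adj_er.counit_naturality_assoc]
    rw [h]
    infer_instance
  have h : R.e.map (cokernel.π (R.r.map g)) = 0 := by
    rw [← cancel_epi (R.e.map (R.r.map g)), ← R.e.map_comp, cokernel.condition, R.e.map_zero,
      comp_zero]
  exact IsZero.of_epi_eq_zero _ h

lemma hasInjectiveDimensionLE_r_obj [EnoughInjectives C] (t : ℕ)
    (h : ∀ X : A, HasInjectiveDimensionLE (R.i.obj X) t) (n : ℕ) (Y : C)
    (hY : HasInjectiveDimensionLE Y n) : HasInjectiveDimensionLE (R.r.obj Y) (n + t + 1) := by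
  induction n generalizing Y with
  | zero =>
    have := injective_iff_hasInjectiveDimensionLT_one.2 hY
    have := R.injective_r_obj Y
    exact hasInjectiveDimensionLT_of_ge _ 1 _ (by lia)
  | succ n hn =>
    let P := Classical.choice (EnoughInjectives.presentation Y)
    have hP := P.shortExact_shortComplex
    have := P.injective
    have := R.injective_r_obj P.J
    have := R.adj_er.isRightAdjoint
    let g := cokernel.π P.f
    obtain ⟨X, ⟨e⟩⟩ := (R.essImage_i_eq_ker_e _).2 (R.isZero_e_obj_cokernel_r_map g)
    have hcoker := hasInjectiveDimensionLT_of_iso e (t + 1)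
    have hK := hn _ ((hP.hasInjectiveDimensionLT_X₃_iff n P.injective).2 hY)
    have hker := hasInjectiveDimensionLT_kernel (R.r.map g) (n + t + 1) hK
      (hasInjectiveDimensionLT_of_ge _ (t + 1) _ (by lia))
    let φ : kernel (R.r.map g) ≅ R.r.obj Y :=
      (PreservesKernel.iso R.r g).symm ≪≫ R.r.mapIso
        ((limit.isLimit _).conePointUniqueUpToIso (hP.fIsKernel))
    have := hasInjectiveDimensionLT_of_iso φ (n + t + 1 + 2)
    exact hasInjectiveDimensionLT_of_ge _ (n + t + 1 + 2) _ (by lia)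

end Recollement

/-- Let `(𝒜, ℬ, 𝒞)` be a recollement of abelian categories, all with enough projectives and
injectives.  If there is `t` such that `id_ℬ i(A) ≤ t` for every object `A` of `𝒜`, then for
every object `C` of `𝒞` one has `id_ℬ r(C) ≤ id_𝒞 C + t + 1`; in particular, the functor
`r : 𝒞 ⥤ ℬ` preserves objects of finite injective dimension. -/
theorem recollement_injDim_r_le {A : Type u₁} {B : Type u₂} {C : Type u₃}
    [Category.{v₁} A] [Category.{v₂} B] [Category.{v₃} C]
    [Abelian A] [Abelian B] [Abelian C]
    [EnoughProjectives A] [EnoughInjectives A]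
    [EnoughProjectives B] [EnoughInjectives B]
    [EnoughProjectives C] [EnoughInjectives C]
    (R : Recollement A B C) (t : ℕ)
    (h : ∀ X : A, injDim (R.i.obj X) ≤ (t : ℕ∞)) :
    (∀ Y : C, injDim (R.r.obj Y) ≤ injDim Y + t + 1) ∧
    (∀ Y : C, injDim Y ≠ ⊤ → injDim (R.r.obj Y) ≠ ⊤) := by
  have := R.hasInjectiveDimensionLE_r_obj t fun X ↦ (injDim_le_iff _ _).1 (h X)
  have key : ∀ Y : C, injDim (R.r.obj Y) ≤ injDim Y + t + 1 := by
    intro Y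
    obtain hY | hY := eq_or_ne (injDim Y) ⊤
    · simp [hY]
    · obtain ⟨n, hn⟩ := ENat.ne_top_iff_exists.1 hY
      rw [← hn]
      exact_mod_cast (injDim_le_iff _ _).2 (this n Y ((injDim_le_iff _ _).1 hn.ge))
  exact ⟨key, fun Y hY ↦ ne_top_of_le_ne_top (by simp [hY]) (key Y)⟩
end

section
/- Let (𝒜, ℬ, 𝒞) be a recollement of abelian categories such that ℬ has enough projectives and injectives. Then pd_ℬ i(P) ≤ 1 for every projective object P of 𝒜 if and only if the functor i : 𝒜 ⥤ ℬ is a homological embedding and the quotient functor e : ℬ ⥤ 𝒞 preserves projective objects. -/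
/-!
A recollement `(𝒜, ℬ, 𝒞)` of abelian categories consists of functors `i : 𝒜 ⥤ ℬ`,
`e : ℬ ⥤ 𝒞`, `q, p : ℬ ⥤ 𝒜` and `l, r : 𝒞 ⥤ ℬ` such that `(l, e)`, `(e, r)`, `(q, i)`,
`(i, p)` are adjoint pairs, the functors `i`, `l` and `r` are fully faithful, and the
essential image of `i` equals the kernel of `e`.

An exact functor `i : 𝒜 ⥤ ℬ` between abelian categories is a homological embedding if for
all objects `X, Y` of `𝒜` and all `n ≥ 0` the induced map `Ext^n_𝒜(X, Y) → Ext^n_ℬ(i X, i Y)`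
is an isomorphism.  (Mathlib has no functoriality of `Ext` along an exact functor, so the
isomorphism condition is rendered here as the existence of an isomorphism of abelian
groups in each degree.)

STATEMENT: suppose `ℬ` has enough projectives and injectives.  Then `pd_ℬ i(P) ≤ 1` for
every projective object `P` of `𝒜` if and only if `i` is a homological embedding and the
quotient functor `e : ℬ ⥤ 𝒞` preserves projective objects.
-/

open CategoryTheory CategoryTheory.Limits

universe w v₁ v₂ v₃ u₁ u₂ u₃

/-- A functor `F : 𝒜 ⥤ ℬ` between abelian categories is a homological embedding if for all
objects `X, Y` of `𝒜` and all `n ≥ 0`, `Ext^n_𝒜(X, Y) ≅ Ext^n_ℬ(F X, F Y)` as abelian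
groups (the paper asks that this isomorphism be the map induced by the exact functor `F`;
the existence of an isomorphism in every degree is how we render this here). -/
def IsHomologicalEmbedding {A : Type u₁} {B : Type u₂}
    [Category.{v₁} A] [Category.{v₂} B] [Abelian A] [Abelian B]
    [HasExt.{w} A] [HasExt.{w} B] (F : A ⥤ B) : Prop :=
  ∀ (n : ℕ) (X Y : A),
    Nonempty (Abelian.Ext.{w} X Y n ≃+ Abelian.Ext.{w} (F.obj X) (F.obj Y) n)

section ProjectiveDimension

variable {B : Type u₂} [Category.{v₂} B] [Abelian B]

/-- The short exact sequence given by the kernel and the image of a morphism. -/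
lemma CategoryTheory.Abelian.shortExact_kernel_factorThruImage {X Y : B} (f : X ⟶ Y) :
    (ShortComplex.mk (kernel.ι f) (Abelian.factorThruImage f) (by
      simp [← cancel_mono (Abelian.image.ι f)])).ShortExact where
  exact := by
    refine ShortComplex.exact_of_f_is_kernel _ (KernelFork.IsLimit.ofι' _ _ fun k hk ↦
      ⟨kernel.lift _ k ?_, kernel.lift_ι _ _ _⟩)
    simpa using hk =≫ Abelian.image.ι f

lemma CategoryTheory.ProjectiveResolution.hasProjectiveDimensionLT_of_isZero {X : B}
    (P : ProjectiveResolution X) (n : ℕ) (hP : ∀ k, n ≤ k → IsZero (P.complex.X k)) :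
    HasProjectiveDimensionLT X n := by
  let := HasExt.standard B
  rw [hasProjectiveDimensionLT_iff]
  intro k hk Y x
  obtain ⟨f, hf, rfl⟩ := P.extMk_surjective x _ rfl
  obtain rfl : f = 0 := (hP k hk).eq_of_src _ _
  exact P.extMk_zero _ rfl

/-- The projective resolution of length one given by a short exact sequence whose first two
terms are projective. -/
noncomputable def CategoryTheory.ShortComplex.ShortExact.projectiveResolution
    {S : ShortComplex B} (hS : S.ShortExact) (h₁ : Projective S.X₁) (h₂ : Projective S.X₂) :
    ProjectiveResolution S.X₃ where
  complex := HomologicalComplex.double S.f (ComplexShape.down_mk 1 0 rfl)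
  projective n := by
    by_cases hn₁ : n = 1
    · subst hn₁
      exact Projective.of_iso (HomologicalComplex.doubleXIso₀ S.f _).symm h₁
    by_cases hn₀ : n = 0
    · subst hn₀
      exact Projective.of_iso (HomologicalComplex.doubleXIso₁ S.f _ (by simp)).symm h₂
    exact (HomologicalComplex.isZero_double_X S.f _ n hn₁ hn₀).projective
  π := (ChainComplex.toSingle₀Equiv _ _).symm
    ⟨(HomologicalComplex.doubleXIso₁ S.f _ (by simp)).hom ≫ S.g, by
      simp [HomologicalComplex.double_d S.f (ComplexShape.down_mk 1 0 rfl) one_ne_zero]⟩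
  quasiIso := ⟨fun n ↦ by
    obtain _ | _ | n := n
    · rw [ChainComplex.quasiIsoAt₀_iff, ShortComplex.quasiIso_iff_of_zeros' _
        (HomologicalComplex.double_d_eq_zero₀ S.f (ComplexShape.down_mk 1 0 rfl) _ _ zero_ne_one)
        rfl rfl]
      refine (ShortComplex.exact_and_epi_g_iff_of_iso (S₂ := S) ?_).2 ⟨hS.exact, hS.epi_g⟩
      have h : (HomologicalComplex.doubleXIso₀ S.f (ComplexShape.down_mk 1 0 rfl)).hom ≫ S.f =
          (HomologicalComplex.double S.f _).d 1 0 ≫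
            (HomologicalComplex.doubleXIso₁ S.f _ one_ne_zero).hom := by
        simp [HomologicalComplex.double_d S.f (ComplexShape.down_mk 1 0 rfl) one_ne_zero]
      exact ShortComplex.isoMk
        (HomologicalComplex.doubleXIso₀ S.f (ComplexShape.down_mk 1 0 rfl))
        (HomologicalComplex.doubleXIso₁ S.f (ComplexShape.down_mk 1 0 rfl) one_ne_zero)
        (Iso.refl _)
        h (by simp; exact (Category.comp_id _).symm)
    · rw [quasiIsoAt_iff_exactAt' _ _ (ChainComplex.exactAt_succ_single_obj _ _),
        HomologicalComplex.exactAt_iff' _ 2 1 0 (by simp) (by simp)]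
      have := hS.mono_f
      refine (ShortComplex.exact_iff_mono _ ?_).2 ?_
      · exact HomologicalComplex.double_d_eq_zero₀ S.f (ComplexShape.down_mk 1 0 rfl) 2 1 (by simp)
      · have : Mono ((HomologicalComplex.double S.f (ComplexShape.down_mk 1 0 rfl)).d 1 0) := by
          rw [HomologicalComplex.double_d S.f (ComplexShape.down_mk 1 0 rfl) one_ne_zero]
          infer_instance
        exact this
    · rw [quasiIsoAt_iff_exactAt' _ _ (ChainComplex.exactAt_succ_single_obj _ _)]
      exact .of_isZero (HomologicalComplex.isZero_double_X S.f _ _ (by simp) (by simp))⟩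

lemma projDim_le_one_iff_hasProjectiveDimensionLE_one [EnoughProjectives B] (X : B) :
    projDim X ≤ 1 ↔ HasProjectiveDimensionLE X 1 := by
  constructor
  · intro h
    have h' : projDim X < 2 := lt_of_le_of_lt h (by norm_num)
    simp only [projDim, iInf_lt_iff] at h'
    obtain ⟨n, ⟨P, hP⟩, hn⟩ := h'
    have hn : n < 2 := by exact_mod_cast hn
    exact P.hasProjectiveDimensionLT_of_isZero _ fun k hk ↦ hP k (by lia)
  · intro h
    let P : ProjectivePresentation X := Classical.arbitrary _
    have hS : (ShortComplex.mk _ _ (kernel.condition P.f)).ShortExact :=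
      { exact := ShortComplex.exact_kernel P.f }
    have := P.projective
    have h₁ : Projective (kernel P.f) := projective_iff_hasProjectiveDimensionLT_one.2
      (hS.hasProjectiveDimensionLT_X₁ 1 (inferInstanceAs (HasProjectiveDimensionLT P.p 1)) h)
    exact iInf₂_le (1 : ℕ) ⟨hS.projectiveResolution h₁ P.projective, fun k hk ↦
      HomologicalComplex.isZero_double_X (kernel.ι P.f) (ComplexShape.down_mk 1 0 rfl) k
        (by lia) (by lia)⟩

end ProjectiveDimension

section HomologicalEmbedding

open Abelian

variable {A : Type u₁} {B : Type u₂} [Category.{v₁} A] [Category.{v₂} B] [Abelian A] [Abelian B]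
  [HasExt.{w} A] [HasExt.{w} B]

attribute [local instance] Ext.subsingleton_of_projective

/-- A fully faithful exact functor induces bijections on `Ext` as soon as the images of projective
objects are acyclic with respect to the objects in the image of the functor. -/
lemma CategoryTheory.Functor.mapExt_bijective_of_subsingleton_ext
    (F : A ⥤ B) [F.Additive] [PreservesFiniteLimits F] [PreservesFiniteColimits F]
    [F.Full] [F.Faithful] [EnoughProjectives A]
    (hF : ∀ (P Y : A) (n : ℕ), Projective P →
      Subsingleton (Ext.{w} (F.obj P) (F.obj Y) (n + 1)))
    (X Y : A) (n : ℕ) :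
    Function.Bijective (F.mapExtAddHom X Y n) := by
  induction n generalizing X with
  | zero => simpa [Ext.mapExactFunctor₀] using ⟨Faithful.map_injective, Full.map_surjective⟩
  | succ n hn =>
    let P : ProjectivePresentation X := Classical.arbitrary _
    let S := ShortComplex.mk _ _ (kernel.condition P.f)
    have : Subsingleton (Ext.{w} (S.map F).X₂ (F.obj Y) (n + 1)) := hF P.p Y n P.projective
    have hS : S.ShortExact := { exact := ShortComplex.exact_kernel P.f }
    have hf : ((Ext.mk₀ (S.map F).f).precomp (F.obj Y) (zero_add n)).comp
        (F.mapExtAddHom S.X₂ Y n) =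
        (F.mapExtAddHom S.X₁ Y n).comp ((Ext.mk₀ S.f).precomp Y (zero_add n)) := by
      ext x
      exact (congrArg (Ext.comp · _ _) (Ext.mapExactFunctor_mk₀ F S.f).symm).trans
        (Ext.mapExactFunctor_comp F (Ext.mk₀ S.f) x (zero_add n)).symm
    have hδ : ((hS.map_of_exact F).extClass.precomp (F.obj Y) (add_comm 1 n)).comp
        (F.mapExtAddHom S.X₁ Y n) =
        (F.mapExtAddHom S.X₃ Y (n + 1)).comp (hS.extClass.precomp Y (add_comm 1 n)) := by
      ext x
      exact (congrArg (Ext.comp · _ _) (Ext.mapExactFunctor_extClass F hS).symm).trans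
        (Ext.mapExactFunctor_comp F hS.extClass x (add_comm 1 n)).symm
    exact AddMonoidHom.bijective_of_surjective_of_bijective_of_right_exact _ _ _ _
      (F.mapExtAddHom S.X₂ Y n) (F.mapExtAddHom S.X₁ Y n) (F.mapExtAddHom S.X₃ Y (n + 1))
      hf hδ
      ((ShortComplex.ab_exact_iff_function_exact _).1
        (Ext.contravariant_sequence_exact₁' hS Y n (n + 1) (add_comm 1 n)))
      ((ShortComplex.ab_exact_iff_function_exact _).1
        (Ext.contravariant_sequence_exact₁' (hS.map F) (F.obj Y) n (n + 1) (add_comm 1 n)))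
      (hn _).surjective (hn _)
      (fun x₃ ↦ Ext.contravariant_sequence_exact₃ hS _ x₃ (by subsingleton) (add_comm 1 n))
      (fun y₃ ↦ Ext.contravariant_sequence_exact₃ (hS.map F) _ y₃ (by subsingleton) (add_comm 1 n))

end HomologicalEmbedding

namespace Recollement

open Abelian

variable {A : Type u₁} {B : Type u₂} {C : Type u₃}
    [Category.{v₁} A] [Category.{v₂} B] [Category.{v₃} C]
    [Abelian A] [Abelian B] [Abelian C] (R : Recollement A B C)

attribute [local instance] i_full i_faithful l_full l_faithful

instance : R.i.IsRightAdjoint := R.adj_qi.isRightAdjoint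

instance : R.i.IsLeftAdjoint := R.adj_ip.isLeftAdjoint

instance : R.e.IsRightAdjoint := R.adj_le.isRightAdjoint

instance : R.e.IsLeftAdjoint := R.adj_er.isLeftAdjoint

instance : R.i.Additive := Functor.additive_of_preserves_binary_products _

instance : R.e.Additive := Functor.additive_of_preserves_binary_products _

lemma isZero_e_obj_i_obj (X : A) : IsZero (R.e.obj (R.i.obj X)) :=
  (R.essImage_i_eq_ker_e _).1 (R.i.obj_mem_essImage X)

lemma eq_zero_of_l_obj {X : C} {Y : B} (hY : IsZero (R.e.obj Y)) (f : R.l.obj X ⟶ Y) : f = 0 :=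
  (R.adj_le.homEquiv _ _).injective (hY.eq_of_tgt _ _)

instance isIso_e_map_counit (X : B) : IsIso (R.e.map (R.adj_le.counit.app X)) := by
  have h := R.adj_le.right_triangle_components X
  have : IsIso (R.adj_le.unit.app (R.e.obj X) ≫ R.e.map (R.adj_le.counit.app X)) := by
    exact h ▸ IsIso.id _
  exact IsIso.of_isIso_comp_left (R.adj_le.unit.app (R.e.obj X)) _

lemma isZero_e_obj_cokernel_counit (X : B) :
    IsZero (R.e.obj (cokernel (R.adj_le.counit.app X))) := by
  refine IsZero.of_epi_eq_zero (R.e.map (cokernel.π (R.adj_le.counit.app X))) ?_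
  rw [← cancel_epi (R.e.map (R.adj_le.counit.app X)), ← R.e.map_comp]
  simp

lemma isZero_e_obj_kernel_counit (X : B) :
    IsZero (R.e.obj (kernel (R.adj_le.counit.app X))) := by
  refine IsZero.of_mono_eq_zero (R.e.map (kernel.ι (R.adj_le.counit.app X))) ?_
  rw [← cancel_mono (R.e.map (R.adj_le.counit.app X)), ← R.e.map_comp]
  simp

lemma enoughProjectives (R : Recollement A B C) [EnoughProjectives B] : EnoughProjectives A where
  presentation X := ⟨{
    p := R.q.obj (Projective.over (R.i.obj X))
    projective := R.adj_qi.map_projective _ inferInstance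
    f := (R.adj_qi.homEquiv _ _).symm (Projective.π (R.i.obj X))
    epi := by
      rw [Adjunction.homEquiv_counit]
      have : R.q.IsLeftAdjoint := R.adj_qi.isLeftAdjoint
      infer_instance }⟩

/-- The object of `A` whose image is the cokernel of the counit `l (e Q) ⟶ Q` is projective
when `Q` is. -/
lemma projective_of_iso_cokernel_counit {Q : B} [Projective Q] {Z : A}
    (φ : R.i.obj Z ≅ cokernel (R.adj_le.counit.app Q)) : Projective Z where
  factors {Y X} f p _ := by
    let g : Q ⟶ R.i.obj Y :=
      Projective.factorThru (cokernel.π _ ≫ φ.inv ≫ R.i.map f) (R.i.map p)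
    have hg : R.adj_le.counit.app Q ≫ g = 0 := R.eq_zero_of_l_obj (R.isZero_e_obj_i_obj Y) _
    refine ⟨R.i.preimage (φ.hom ≫ cokernel.desc _ g hg), R.i.map_injective ?_⟩
    rw [R.i.map_comp, R.i.map_preimage, Category.assoc, ← cancel_epi φ.inv,
      φ.inv_hom_id_assoc, ← cancel_epi (cokernel.π _), cokernel.π_desc_assoc]
    simp [g]

/-- An epimorphism onto the image of a projective object splits if its source is in the
essential image of `i`. -/
lemma exists_section {E : B} (hE : IsZero (R.e.obj E)) {P : A} [Projective P]
    (f : E ⟶ R.i.obj P) [Epi f] : ∃ s : R.i.obj P ⟶ E, s ≫ f = 𝟙 _ := by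
  obtain ⟨Z, ⟨φ⟩⟩ := (R.essImage_i_eq_ker_e _).2 hE
  have : Epi (R.i.map (R.i.preimage (φ.hom ≫ f))) := by
    rw [R.i.map_preimage]
    infer_instance
  have : Epi (R.i.preimage (φ.hom ≫ f)) := R.i.epi_of_epi_map this
  obtain ⟨s, hs⟩ := Projective.factors (𝟙 P) (R.i.preimage (φ.hom ≫ f))
  refine ⟨R.i.map s ≫ φ.hom, ?_⟩
  rw [Category.assoc, ← R.i.map_preimage (φ.hom ≫ f), ← R.i.map_comp, hs, R.i.map_id]

/-- The object `i P` is a retract of the cokernel of the counit `l (e Q) ⟶ Q` for any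
epimorphism `Q ⟶ i P`. -/
lemma nonempty_retract_cokernel_counit {Q : B} {P : A} [Projective P]
    (f : Q ⟶ R.i.obj P) [Epi f] :
    Nonempty (Retract (R.i.obj P) (cokernel (R.adj_le.counit.app Q))) := by
  have hf : R.adj_le.counit.app Q ≫ f = 0 := R.eq_zero_of_l_obj (R.isZero_e_obj_i_obj P) _
  have : Epi (cokernel.desc _ f hf) := epi_of_epi_fac (cokernel.π_desc _ f hf)
  obtain ⟨s, hs⟩ := R.exists_section (R.isZero_e_obj_cokernel_counit Q) (cokernel.desc _ f hf)
  exact ⟨{ i := s, r := cokernel.desc _ f hf, retract := hs }⟩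

/-- The short exact sequence `0 ⟶ ker (Q ⟶ Z) ⟶ Q ⟶ Z ⟶ 0`, where `Z` is the cokernel of
the counit `l (e Q) ⟶ Q`. -/
lemma shortExact_cokernel_counit (Q : B) :
    (ShortComplex.mk (Abelian.image.ι (R.adj_le.counit.app Q))
      (cokernel.π (R.adj_le.counit.app Q)) (by simp)).ShortExact where
  exact := ShortComplex.exact_kernel _

lemma projective_e_obj {Q : B} [Projective Q]
    (hQ : HasProjectiveDimensionLE (cokernel (R.adj_le.counit.app Q)) 1) :
    Projective (R.e.obj Q) := by
  have : Projective (Abelian.image (R.adj_le.counit.app Q)) :=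
    projective_iff_hasProjectiveDimensionLT_one.2
      ((R.shortExact_cokernel_counit Q).hasProjectiveDimensionLT_X₁ 1
        (inferInstanceAs (HasProjectiveDimensionLT Q 1)) hQ)
  let c := Abelian.factorThruImage (R.adj_le.counit.app Q)
  let s := Projective.factorThru (𝟙 _) c
  have hs : s ≫ c = 𝟙 _ := Projective.factorThru_comp _ _
  have hcs : (𝟙 _ - c ≫ s) ≫ R.adj_le.counit.app Q = 0 := by
    have hc : c ≫ Abelian.image.ι _ = R.adj_le.counit.app Q := Abelian.image.fac _
    have h : (𝟙 _ - c ≫ s) ≫ c = 0 := by simp [Preadditive.sub_comp, hs]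
    have h' := h =≫ Abelian.image.ι _
    rwa [Category.assoc, hc, zero_comp] at h'
  have h : 𝟙 _ - c ≫ s = 0 := by
    rw [← kernel.lift_ι _ _ hcs, R.eq_zero_of_l_obj (R.isZero_e_obj_kernel_counit Q)
      (kernel.lift _ _ hcs), zero_comp]
  have : Projective (R.l.obj (R.e.obj Q)) :=
    Projective.of_iso ⟨s, c, hs, (sub_eq_zero.1 h).symm⟩ this
  exact R.adj_le.projective_of_map_projective _ this

lemma hasProjectiveDimensionLE_cokernel_counit [HasExt.{w} B] {Q : B} [Projective Q]
    (hQ : Projective (R.e.obj Q))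
    (h : ∀ Y : A, Subsingleton
      (Ext.{w} (cokernel (R.adj_le.counit.app Q)) (R.i.obj Y) 2)) :
    HasProjectiveDimensionLE (cokernel (R.adj_le.counit.app Q)) 1 := by
  have hlQ : Projective (R.l.obj (R.e.obj Q)) := R.adj_le.map_projective _ hQ
  have hS := R.shortExact_cokernel_counit Q
  have hT := shortExact_kernel_factorThruImage (R.adj_le.counit.app Q)
  obtain ⟨N, ⟨φ⟩⟩ := (R.essImage_i_eq_ker_e _).2 (R.isZero_e_obj_kernel_counit Q)
  have hφ : hT.extClass.comp (Ext.mk₀ φ.inv) (add_zero 1) = 0 := by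
    obtain ⟨y, hy⟩ := Ext.contravariant_sequence_exact₁ hS _
      (hT.extClass.comp (Ext.mk₀ φ.inv) (add_zero 1)) (n₁ := 2) rfl ((h N).elim _ _)
    rw [← hy, Ext.eq_zero_of_projective (P := Q) y, Ext.comp_zero]
  obtain ⟨y, hy⟩ := Ext.contravariant_sequence_exact₁ hT _ (Ext.mk₀ φ.inv) (n₁ := 1) rfl hφ
  obtain ⟨y, rfl⟩ := Ext.homEquiv₀.symm.surjective y
  obtain rfl : y = 0 := R.eq_zero_of_l_obj (R.isZero_e_obj_i_obj N) y
  have hφ' : φ.inv = 0 := Ext.homEquiv₀.symm.injective (by simpa using hy.symm)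
  have hN : IsZero (kernel (R.adj_le.counit.app Q)) := IsZero.of_mono_eq_zero _ hφ'
  have : Mono (Abelian.factorThruImage (R.adj_le.counit.app Q)) :=
    hT.exact.mono_g (hN.eq_of_src _ _)
  have : IsIso (Abelian.factorThruImage (R.adj_le.counit.app Q)) := isIso_of_mono_of_epi _
  have : Projective (Abelian.image (R.adj_le.counit.app Q)) :=
    Projective.of_iso (asIso (Abelian.factorThruImage (R.adj_le.counit.app Q))) hlQ
  exact hS.hasProjectiveDimensionLT_X₃ 1
    (inferInstanceAs (HasProjectiveDimensionLT (Abelian.image _) 1))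
    (inferInstanceAs (HasProjectiveDimensionLT Q 2))

/-- The essential image of `i` is closed under extensions, so that the image of a projective object
has no nontrivial extension by an object in the image of `i`. -/
lemma subsingleton_ext_one [EnoughInjectives B] [HasExt.{w} B] (P Y : A) [Projective P] :
    Subsingleton (Ext.{w} (R.i.obj P) (R.i.obj Y) 1) := by
  let I : InjectivePresentation (R.i.obj Y) := Classical.arbitrary _
  have := I.injective
  have hS : (ShortComplex.mk _ _ (cokernel.condition I.f)).ShortExact :=
    { exact := ShortComplex.exact_cokernel I.f }
  refine subsingleton_of_forall_eq 0 fun x ↦ ?_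
  obtain ⟨y, rfl⟩ := Ext.covariant_sequence_exact₁ _ hS x
    (Ext.eq_zero_of_injective (I := I.J) _) (zero_add 1)
  obtain ⟨y, rfl⟩ := Ext.homEquiv₀.symm.surjective y
  have sq := IsPullback.of_hasPullback (cokernel.π I.f) y
  have : Mono (R.e.map (cokernel.π I.f)) :=
    (hS.map_of_exact R.e).exact.mono_g ((R.isZero_e_obj_i_obj Y).eq_of_src _ _)
  have : Mono (R.e.map (pullback.snd (cokernel.π I.f) y)) :=
    (MorphismProperty.monomorphisms C).of_isPullback (sq.map R.e) (.infer_property _)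
  obtain ⟨s, hs⟩ := R.exists_section
    (IsZero.of_mono (R.e.map (pullback.snd (cokernel.π I.f) y)) (R.isZero_e_obj_i_obj P))
    (pullback.snd (cokernel.π I.f) y)
  have hy : y = (s ≫ pullback.fst (cokernel.π I.f) y) ≫ cokernel.π I.f := by
    rw [Category.assoc, pullback.condition, reassoc_of% hs]
  have hS' := hS.comp_extClass
  dsimp at hS'
  rw [hy, Ext.homEquiv₀_symm_apply, ← Ext.mk₀_comp_mk₀,
    Ext.comp_assoc_of_second_deg_zero, hS', Ext.comp_zero]

end Recollement

/-- Let `(𝒜, ℬ, 𝒞)` be a recollement of abelian categories such that `ℬ` has enough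
projectives and injectives.  Then `pd_ℬ i(P) ≤ 1` for every projective object `P` of `𝒜`
if and only if the functor `i : 𝒜 ⥤ ℬ` is a homological embedding and the quotient functor
`e : ℬ ⥤ 𝒞` preserves projective objects. -/
theorem recollement_pd_i_le_one_iff {A : Type u₁} {B : Type u₂} {C : Type u₃}
    [Category.{v₁} A] [Category.{v₂} B] [Category.{v₃} C]
    [Abelian A] [Abelian B] [Abelian C]
    [EnoughProjectives B] [EnoughInjectives B]
    [HasExt.{w} A] [HasExt.{w} B]
    (R : Recollement A B C) :
    (∀ P : A, Projective P → projDim (R.i.obj P) ≤ (1 : ℕ∞)) ↔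
    (IsHomologicalEmbedding.{w} R.i ∧
      ∀ P : B, Projective P → Projective (R.e.obj P)) := by
  have := R.i_full
  have := R.i_faithful
  simp only [projDim_le_one_iff_hasProjectiveDimensionLE_one]
  constructor
  · intro h
    have := R.enoughProjectives
    refine ⟨fun n X Y ↦ ⟨AddEquiv.ofBijective (R.i.mapExtAddHom X Y n)
      (R.i.mapExt_bijective_of_subsingleton_ext (fun P Y n hP ↦ ?_) X Y n)⟩, fun Q hQ ↦ ?_⟩
    · obtain _ | n := n
      · exact R.subsingleton_ext_one P Y
      · have := h P hP
        exact HasProjectiveDimensionLT.subsingleton _ 2 _ (by lia) _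
    · obtain ⟨Z, ⟨φ⟩⟩ := (R.essImage_i_eq_ker_e _).2 (R.isZero_e_obj_cokernel_counit Q)
      have := h Z (R.projective_of_iso_cokernel_counit φ)
      exact R.projective_e_obj (hasProjectiveDimensionLT_of_iso φ 2)
  · rintro ⟨hi, he⟩ P hP
    obtain ⟨ρ⟩ := R.nonempty_retract_cokernel_counit (Projective.π (R.i.obj P))
    obtain ⟨Z, ⟨φ⟩⟩ := (R.essImage_i_eq_ker_e _).2
      (R.isZero_e_obj_cokernel_counit (Projective.over (R.i.obj P)))
    have hZ : Projective Z := R.projective_of_iso_cokernel_counit φ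
    have := R.hasProjectiveDimensionLE_cokernel_counit
      (he (Projective.over (R.i.obj P)) inferInstance) (fun Y ↦ by
        have := Abelian.Ext.subsingleton_of_projective Z Y 1
        have := (hi 2 Z Y).some.symm.subsingleton
        refine subsingleton_of_forall_eq 0 fun x ↦ ?_
        rw [← x.mk₀_id_comp, ← φ.inv_hom_id, ← Abelian.Ext.mk₀_comp_mk₀,
          Abelian.Ext.comp_assoc_of_second_deg_zero,
          Subsingleton.elim ((Abelian.Ext.mk₀ φ.hom).comp x (zero_add 2)) 0,
          Abelian.Ext.comp_zero])
    exact ρ.hasProjectiveDimensionLT 2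
end

section
/- Let (𝒜, ℬ, 𝒞) be a recollement of abelian categories, all with enough projectives and injectives, such that 𝒜 is a finite length category and ℬ has projective covers. Assume that the functor e : ℬ ⥤ 𝒞 is a t-eventually homological isomorphism. Then Findim 𝒞 ≤ max{Findim ℬ, t} and Findim ℬ ≤ max{Findim 𝒞, t}; in particular, Findim ℬ < ∞ if and only if Findim 𝒞 < ∞. -/
/-!
A recollement `(𝒜, ℬ, 𝒞)` of abelian categories consists of functors `i : 𝒜 ⥤ ℬ`,
`e : ℬ ⥤ 𝒞`, `q, p : ℬ ⥤ 𝒜` and `l, r : 𝒞 ⥤ ℬ` such that `(l, e)`, `(e, r)`, `(q, i)`,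
`(i, p)` are adjoint pairs, the functors `i`, `l` and `r` are fully faithful, and the
essential image of `i` equals the kernel of `e`.

A functor `E : ℬ ⥤ 𝒞` between abelian categories is a `t`-eventually homological
isomorphism (for a positive integer `t`) if for all objects `B, B′` of `ℬ` and all
`n > t` there is a group isomorphism `Ext^n_ℬ(B, B′) ≅ Ext^n_𝒞(E B, E B′)`.

STATEMENT: suppose all three categories have enough projectives and injectives, `𝒜` is a
finite length category, `ℬ` has projective covers, and `e : ℬ ⥤ 𝒞` is a `t`-eventually
homological isomorphism.  Then `Findim 𝒞 ≤ max {Findim ℬ, t}` and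
`Findim ℬ ≤ max {Findim 𝒞, t}`; in particular `Findim ℬ < ∞` iff `Findim 𝒞 < ∞`.
-/

open CategoryTheory CategoryTheory.Limits

universe w v₁ v₂ v₃ u₁ u₂ u₃

namespace CategoryTheory

namespace ShortComplex.Exact

variable {C : Type u₁} [Category.{v₁} C] [Abelian C] {S : ShortComplex C}

lemma comp_f_of_epi (hS : S.Exact) {X : C} (p : X ⟶ S.X₁) [Epi p] :
    (ShortComplex.mk (p ≫ S.f) S.g (by rw [Category.assoc, S.zero, comp_zero])).Exact := by
  let φ : ShortComplex.mk (p ≫ S.f) S.g (by rw [Category.assoc, S.zero, comp_zero]) ⟶ S :=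
    { τ₁ := p, τ₂ := 𝟙 _, τ₃ := 𝟙 _ }
  exact (ShortComplex.exact_iff_of_epi_of_isIso_of_mono φ).2 hS

lemma comp_g_of_mono (hS : S.Exact) {X : C} (j : S.X₃ ⟶ X) [Mono j] :
    (ShortComplex.mk S.f (S.g ≫ j) (by rw [S.zero_assoc, zero_comp])).Exact := by
  let φ : S ⟶ ShortComplex.mk S.f (S.g ≫ j) (by rw [S.zero_assoc, zero_comp]) :=
    { τ₁ := 𝟙 _, τ₂ := 𝟙 _, τ₃ := j }
  exact (ShortComplex.exact_iff_of_epi_of_isIso_of_mono φ).1 hS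

end ShortComplex.Exact

namespace ProjectiveResolution

variable {C : Type u₁} [Category.{v₁} C] [Abelian C]

/-- The augmentation of a projective resolution of `Z`, as a morphism to `Z`. -/
noncomputable def augmentation {Z : C} (P : ProjectiveResolution Z) : P.complex.X 0 ⟶ Z :=
  P.π.f 0

instance {Z : C} (P : ProjectiveResolution Z) : Epi P.augmentation :=
  inferInstanceAs (Epi (P.π.f 0))

lemma d_comp_augmentation {Z : C} (P : ProjectiveResolution Z) :
    P.complex.d 1 0 ≫ P.augmentation = 0 :=
  P.complex_d_comp_π_f_zero

lemma exact_augmentation {Z : C} (P : ProjectiveResolution Z) :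
    (ShortComplex.mk _ _ P.d_comp_augmentation).Exact :=
  P.exact₀

/-- Splice a projective resolution of `X₁` with a short exact sequence
`0 ⟶ X₁ ⟶ X₂ ⟶ X₃ ⟶ 0` with `X₂` projective into a projective resolution of `X₃`. -/
noncomputable def splice {S : ShortComplex C} (hS : S.ShortExact) [Projective S.X₂]
    (P : ProjectiveResolution S.X₁) : ProjectiveResolution S.X₃ where
  complex := P.complex.augment (P.augmentation ≫ S.f)
    (by rw [← Category.assoc, d_comp_augmentation, zero_comp])
  projective n := by
    cases n with
    | zero => exact inferInstanceAs (Projective S.X₂)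
    | succ n => exact inferInstanceAs (Projective (P.complex.X n))
  π := (ChainComplex.toSingle₀Equiv _ _).symm ⟨S.g, by
    rw [ChainComplex.augment_d_one_zero]
    have h : (P.augmentation ≫ S.f) ≫ S.g = 0 := by rw [Category.assoc, S.zero, comp_zero]
    exact h⟩
  quasiIso := ⟨fun n => by
    have := hS.epi_g
    have := hS.mono_f
    match n with
    | 0 =>
      rw [ChainComplex.quasiIsoAt₀_iff, ShortComplex.quasiIso_iff_of_zeros' _ rfl rfl rfl]
      refine (ShortComplex.exact_and_epi_g_iff_of_iso ?_).2
        ⟨hS.exact.comp_f_of_epi P.augmentation, hS.epi_g⟩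
      refine ShortComplex.isoMk (Iso.refl _) (Iso.refl _) (Iso.refl _) ?_ ?_
      · exact (Category.id_comp _).trans (Category.comp_id _).symm
      · refine (Category.id_comp _).trans (Eq.trans ?_ (Category.comp_id _).symm)
        exact (ChainComplex.toSingle₀Equiv_symm_apply_f_zero
          (C := P.complex.augment (P.augmentation ≫ S.f) _) S.g _).symm
    | 1 =>
      rw [quasiIsoAt_iff_exactAt' _ _ (ChainComplex.exactAt_succ_single_obj _ _),
        HomologicalComplex.exactAt_iff' _ 2 1 0 (by simp) (by simp)]
      exact P.exact_augmentation.comp_g_of_mono (X := S.X₂) S.f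
    | n + 2 =>
      rw [quasiIsoAt_iff_exactAt' _ _ (ChainComplex.exactAt_succ_single_obj _ _),
        HomologicalComplex.exactAt_iff' _ (n + 3) (n + 2) (n + 1) (by simp) (by simp)]
      exact P.exact_succ n⟩

end ProjectiveResolution

end CategoryTheory

section ProjDim

variable {C : Type u₁} [Category.{v₁} C] [Abelian C]

lemma hasProjectiveDimensionLT_of_projectiveResolution {X : C} (P : ProjectiveResolution X)
    {n : ℕ} (hP : ∀ k, n < k → IsZero (P.complex.X k)) :
    HasProjectiveDimensionLT X (n + 1) := by
  let _ := HasExt.standard C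
  rw [hasProjectiveDimensionLT_iff]
  intro i hi Y x
  obtain ⟨f, -, rfl⟩ := P.extMk_surjective x (i + 1) rfl
  obtain rfl : f = 0 := (hP i hi).eq_of_src _ _
  simp

lemma exists_projectiveResolution_of_hasProjectiveDimensionLT [EnoughProjectives C] (n : ℕ)
    (X : C) [HasProjectiveDimensionLT X (n + 1)] :
    ∃ P : ProjectiveResolution X, ∀ k, n < k → IsZero (P.complex.X k) := by
  induction n generalizing X with
  | zero =>
    have : Projective X := projective_iff_hasProjectiveDimensionLT_one.2 inferInstance
    refine ⟨ProjectiveResolution.self X, fun k hk => ?_⟩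
    exact HomologicalComplex.isZero_single_obj_X _ _ _ _ hk.ne'
  | succ n ih =>
    let S := ShortComplex.mk (kernel.ι (Projective.π X)) (Projective.π X) (by simp)
    have hS : S.ShortExact :=
      { exact := ShortComplex.exact_kernel _
        mono_f := inferInstanceAs (Mono (kernel.ι _))
        epi_g := inferInstanceAs (Epi (Projective.π X)) }
    have h₂ : Projective S.X₂ := inferInstanceAs (Projective (Projective.over X))
    have := (hS.hasProjectiveDimensionLT_X₃_iff n h₂).1 ‹_›
    obtain ⟨P, hP⟩ := ih S.X₁
    refine ⟨P.splice hS, fun k hk => ?_⟩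
    cases k with
    | zero => omega
    | succ k => exact hP k (by omega)

lemma projDim_le_iff [EnoughProjectives C] (X : C) (n : ℕ) :
    projDim X ≤ n ↔ HasProjectiveDimensionLT X (n + 1) := by
  constructor
  · intro h
    have h' : projDim X < ((n + 1 : ℕ) : ℕ∞) := lt_of_le_of_lt h (by exact_mod_cast n.lt_succ_self)
    simp only [projDim, iInf_lt_iff] at h'
    obtain ⟨m, ⟨P, hP⟩, hm⟩ := h'
    have hm : m < n + 1 := by exact_mod_cast hm
    exact hasProjectiveDimensionLT_of_projectiveResolution P fun k hk => hP k (by omega)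
  · intro _
    exact iInf₂_le n (exists_projectiveResolution_of_hasProjectiveDimensionLT n X)

lemma projDim_eq_of_iso [EnoughProjectives C] {X Y : C} (e : X ≅ Y) : projDim X = projDim Y := by
  have key {X Y : C} (e : X ≅ Y) : projDim X ≤ projDim Y := by
    by_cases hY : projDim Y = ⊤
    · simp [hY]
    obtain ⟨m, hm⟩ := ENat.ne_top_iff_exists.1 hY
    have := (projDim_le_iff Y m).1 hm.ge
    rw [← hm, projDim_le_iff]
    exact hasProjectiveDimensionLT_of_iso e.symm (m + 1)
  exact le_antisymm (key e) (key e.symm)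

lemma projDim_le_max_of_forall [EnoughProjectives C] {D : Type u₂} [Category.{v₂} D] [Abelian D]
    [EnoughProjectives D] [HasExt.{w} C] [HasExt.{w} D] {X : C} {Z : D} {t : ℕ}
    (h : ∀ Y : C, ∃ W : D, ∀ n, t < n →
      Nonempty (Abelian.Ext.{w} X Y n ≃+ Abelian.Ext.{w} Z W n)) :
    projDim X ≤ max (projDim Z) t := by
  by_cases hZ : projDim Z = ⊤
  · simp [hZ]
  obtain ⟨m, hm⟩ := ENat.ne_top_iff_exists.1 hZ
  have : HasProjectiveDimensionLT Z (m + 1) := (projDim_le_iff Z m).1 hm.ge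
  rw [← hm, ← Nat.mono_cast.map_max, projDim_le_iff, hasProjectiveDimensionLT_iff]
  intro i hi Y x
  obtain ⟨W, hW⟩ := h Y
  obtain ⟨φ⟩ := hW i (by omega)
  apply φ.injective
  rw [map_zero]
  exact (φ x).eq_zero_of_hasProjectiveDimensionLT (m + 1) (by omega)

lemma catFindim_le_max_of_forall {D : Type u₂} [Category.{v₂} D] [Abelian D] {t : ℕ}
    (h : ∀ X : C, ∃ Z : D, projDim X ≤ max (projDim Z) t ∧ projDim Z ≤ max (projDim X) t) :
    catFindim C ≤ max (catFindim D) t := by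
  refine iSup₂_le fun X hX => ?_
  obtain ⟨Z, hXZ, hZX⟩ := h X
  have hZ : projDim Z ≠ ⊤ :=
    (lt_of_le_of_lt hZX (max_lt (lt_top_iff_ne_top.2 hX) (ENat.natCast_lt_top t))).ne
  exact hXZ.trans (max_le_max_right _ (le_iSup₂_of_le Z hZ le_rfl))

end ProjDim

/-- Let `(𝒜, ℬ, 𝒞)` be a recollement of abelian categories, all with enough projectives and
injectives, such that `𝒜` is a finite length category and `ℬ` has projective covers.
Assume that the functor `e : ℬ ⥤ 𝒞` is a `t`-eventually homological isomorphism.  Then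
`Findim 𝒞 ≤ max {Findim ℬ, t}` and `Findim ℬ ≤ max {Findim 𝒞, t}`; in particular,
`Findim ℬ` is finite if and only if `Findim 𝒞` is finite. -/
theorem recollement_findim_of_eventually_homological_iso
    {A : Type u₁} {B : Type u₂} {C : Type u₃}
    [Category.{v₁} A] [Category.{v₂} B] [Category.{v₃} C]
    [Abelian A] [Abelian B] [Abelian C]
    [EnoughProjectives A] [EnoughInjectives A]
    [EnoughProjectives B] [EnoughInjectives B]
    [EnoughProjectives C] [EnoughInjectives C]
    [HasExt.{w} B] [HasExt.{w} C]
    (R : Recollement A B C)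
    (hA : FiniteLengthCategory A) (hB : HasProjectiveCovers B)
    (t : ℕ) (ht : 0 < t)
    (he : ∀ (X Y : B) (n : ℕ), t < n →
      Nonempty (Abelian.Ext.{w} X Y n ≃+ Abelian.Ext.{w} (R.e.obj X) (R.e.obj Y) n)) :
    catFindim C ≤ max (catFindim B) (t : ℕ∞) ∧
    catFindim B ≤ max (catFindim C) (t : ℕ∞) ∧
    (catFindim B ≠ ⊤ ↔ catFindim C ≠ ⊤) := by
  have := R.r_full
  have := R.r_faithful
  let counitIso (Z : C) : R.e.obj (R.r.obj Z) ≅ Z := asIso (R.adj_er.counit.app Z)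
  have hBC (X : B) : projDim X ≤ max (projDim (R.e.obj X)) t :=
    projDim_le_max_of_forall fun Y => ⟨R.e.obj Y, he X Y⟩
  have hCB (X : B) : projDim (R.e.obj X) ≤ max (projDim X) t := by
    refine projDim_le_max_of_forall fun Z => ⟨R.r.obj Z, fun n hn => ?_⟩
    obtain ⟨φ⟩ := he X (R.r.obj Z) n hn
    exact ⟨(((Abelian.extFunctorObj (R.e.obj X) n).mapIso
      (counitIso Z).symm).addCommGroupIsoToAddEquiv).trans φ.symm⟩
  have h₁ : catFindim C ≤ max (catFindim B) t := by
    refine catFindim_le_max_of_forall fun Z => ⟨R.r.obj Z, ?_⟩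
    rw [← projDim_eq_of_iso (counitIso Z)]
    exact ⟨hCB _, hBC _⟩
  have h₂ : catFindim B ≤ max (catFindim C) t :=
    catFindim_le_max_of_forall fun X => ⟨R.e.obj X, hBC X, hCB X⟩
  refine ⟨h₁, h₂, fun h => ?_, fun h => ?_⟩
  · exact (lt_of_le_of_lt h₁ (max_lt (lt_top_iff_ne_top.2 h) (ENat.natCast_lt_top t))).ne
  · exact (lt_of_le_of_lt h₂ (max_lt (lt_top_iff_ne_top.2 h) (ENat.natCast_lt_top t))).ne
end
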